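/- arXiv:2605.13582 — 2 statements merged into one kernel-verified Lean document; each statement's English description precedes it below -/
import Mathlib

section
/- (Property (M1): kinetic trajectory identity.) For every m = (m_0,m_1,m_2) ∈ ℝ × ℝ^d × ℝ^d with m_0 ≠ 0, every (t,x,v) ∈ ℝ^{1+2d} and every r > 0, the trajectory satisfies (d/dr) γ^m_x(r;(t,x,v)) = (d/dr) γ^m_t(r;(t,x,v)) · γ^m_v(r;(t,x,v)); equivalently, (d/dr) γ^m_x(r;(t,x,v)) = 2 m_0 r · γ^m_v(r;(t,x,v)). -/
open MeasureTheory Real ENNReal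
open scoped RealInnerProductSpace

noncomputable section

/-- Euclidean space `ℝ^d`. -/
abbrev V (d : ℕ) : Type := EuclideanSpace ℝ (Fin d)

/-- The kinetic phase space `ℝ^{1+2d}`, with points `(t, x, v)`. -/
abbrev Pt (d : ℕ) : Type := ℝ × V d × V d

/-- Kinetic composition `(t,x,v) ∘ (s,y,w) = (t+s, x+y+s v, v+w)`. -/
def kmul {d : ℕ} (a b : Pt d) : Pt d :=
  (a.1 + b.1, a.2.1 + b.2.1 + b.1 • a.2.2, a.2.2 + b.2.2)

/-- Kinetic inverse `(t,x,v)⁻¹ = (−t, −x+t v, −v)`. -/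
def kinv {d : ℕ} (a : Pt d) : Pt d :=
  (-a.1, -a.2.1 + a.1 • a.2.2, -a.2.2)

/-- `g₁(r) = r³ sin(log r)`, extended by `0` at `r = 0`. -/
def g1 (r : ℝ) : ℝ := r ^ 3 * Real.sin (Real.log r)

/-- `g₂(r) = r³ cos(log r)`, extended by `0` at `r = 0`. -/
def g2 (r : ℝ) : ℝ := r ^ 3 * Real.cos (Real.log r)

/-- `ġ₁(r)/(2r) = (r/2)(3 sin(log r) + cos(log r))`, extended by `0` at `r = 0`. -/
def h1 (r : ℝ) : ℝ := r / 2 * (3 * Real.sin (Real.log r) + Real.cos (Real.log r))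

/-- `ġ₂(r)/(2r) = (r/2)(3 cos(log r) − sin(log r))`, extended by `0` at `r = 0`. -/
def h2 (r : ℝ) : ℝ := r / 2 * (3 * Real.cos (Real.log r) - Real.sin (Real.log r))

/-- The matrix `W(r)`, recorded through its scalar block entries as a `2×2` real matrix;
the full `2d×2d` matrix is the blockwise tensor with `Id_d`. -/
def Wm (r : ℝ) : Matrix (Fin 2) (Fin 2) ℝ := !![g1 r, g2 r; h1 r, h2 r]

/-- The matrix `D_δ` (scalar block entries). -/
def Dm (δ : ℝ) : Matrix (Fin 2) (Fin 2) ℝ := !![δ, 0; 0, 1]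

/-- The matrix `E_δ(r)` (scalar block entries). -/
def Em (δ r : ℝ) : Matrix (Fin 2) (Fin 2) ℝ := !![1, δ * r ^ 2; 0, 1]

/-- `A_{m₀}(r) = D_{m₀} W(r) D_{m₀}⁻¹` (scalar block entries). -/
def Am (m0 r : ℝ) : Matrix (Fin 2) (Fin 2) ℝ := Dm m0 * Wm r * (Dm m0)⁻¹

/-- The action on `ℝ^d × ℝ^d` of a `2×2` block matrix whose blocks are the scalar
multiples of `Id_d` given by the entries of `M`. -/
def act {d : ℕ} (M : Matrix (Fin 2) (Fin 2) ℝ) (p : V d × V d) : V d × V d :=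
  (M 0 0 • p.1 + M 0 1 • p.2, M 1 0 • p.1 + M 1 1 • p.2)

/-- The kinetic trajectory `γ^m(r; (t,x,v))`. -/
def gammaK {d : ℕ} (m : Pt d) (z : Pt d) (r : ℝ) : Pt d :=
  (z.1 + m.1 * r ^ 2,
   (act (Em m.1 r) (z.2.1, z.2.2) + act (Am m.1 r) (m.2.1, m.2.2)).1,
   (act (Em m.1 r) (z.2.1, z.2.2) + act (Am m.1 r) (m.2.1, m.2.2)).2)

/-- Build a vector of `ℝ^d` from components. -/
def mkV {d : ℕ} (f : Fin d → ℝ) : V d := (EuclideanSpace.equiv (Fin d) ℝ).symm f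

/-- The argument `(s/r², A_{s/r²}(r)⁻¹ (y,w)ᵀ)` fed into `ψ`. -/
def psiArg {d : ℕ} (r : ℝ) (m : Pt d) : Pt d :=
  (m.1 / r ^ 2,
   (act ((Am (m.1 / r ^ 2) r)⁻¹) (m.2.1, m.2.2)).1,
   (act ((Am (m.1 / r ^ 2) r)⁻¹) (m.2.1, m.2.2)).2)

/-- The mollification kernel `K_r(s,y,w) = 2^d r^{−Q} ψ(s/r², A_{s/r²}(r)⁻¹(y,w)ᵀ)`,
with `Q = 4d+2`. -/
def Kker {d : ℕ} (ψ : Pt d → ℝ) (r : ℝ) (m : Pt d) : ℝ :=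
  2 ^ d * r ^ (-(4 * (d : ℤ) + 2)) * ψ (psiArg r m)

/-- The kernel `K̃_r(s,y,w) = −2^{d+1} s r^{−Q−1} ψ(s/r², A_{s/r²}(r)⁻¹(y,w)ᵀ)`. -/
def Ktil {d : ℕ} (ψ : Pt d → ℝ) (r : ℝ) (m : Pt d) : ℝ :=
  -(2 ^ (d + 1)) * m.1 * r ^ (-(4 * (d : ℤ) + 2) - 1) * ψ (psiArg r m)

/-- First coefficient of the forcing matrix `F_{m₀}(r)`: `(1/m₀) ∂_r (ġ₁(r)/(2r))`. -/
def F1 (m0 r : ℝ) : ℝ := (1 / m0) * deriv h1 r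

/-- Second coefficient of the forcing matrix `F_{m₀}(r)`: `∂_r (ġ₂(r)/(2r))`. -/
def F2 (r : ℝ) : ℝ := deriv h2 r

/-- The kernel `K⃗_r(s,y,w) = −2^d r^{−Q} ψ(⋯) F_{s/r²}(r) A_{s/r²}(r)⁻¹ (y,w)ᵀ ∈ ℝ^d`. -/
def Kvec {d : ℕ} (ψ : Pt d → ℝ) (r : ℝ) (m : Pt d) : V d :=
  (-(2 ^ d) * r ^ (-(4 * (d : ℤ) + 2)) * ψ (psiArg r m)) •
    (F1 (m.1 / r ^ 2) r • (act ((Am (m.1 / r ^ 2) r)⁻¹) (m.2.1, m.2.2)).1 +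
      F2 r • (act ((Am (m.1 / r ^ 2) r)⁻¹) (m.2.1, m.2.2)).2)

/-- The gradient of `u : ℝ^{1+2d} → ℝ` in the `x`-variables (the `m₁` block). -/
def gradX {d : ℕ} (u : Pt d → ℝ) (z : Pt d) : V d :=
  mkV fun i => fderiv ℝ u z (0, EuclideanSpace.single i 1, 0)

/-- The gradient of `u : ℝ^{1+2d} → ℝ` in the `v`-variables (the `m₂` block). -/
def gradV {d : ℕ} (u : Pt d → ℝ) (z : Pt d) : V d :=
  mkV fun i => fderiv ℝ u z (0, 0, EuclideanSpace.single i 1)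

/-- The kernel `K⃗^π_r(s,y,w)
  = 2^{d+1} s r^{−Q−1} [(A_{s/r²}(r)⁻¹)_{·;2}]ᵀ [∇_{(m₁,m₂)}ψ](⋯) ∈ ℝ^d`. -/
def Kpi {d : ℕ} (ψ : Pt d → ℝ) (r : ℝ) (m : Pt d) : V d :=
  (2 ^ (d + 1) * m.1 * r ^ (-(4 * (d : ℤ) + 2) - 1)) •
    ((Am (m.1 / r ^ 2) r)⁻¹ 0 1 • gradX ψ (psiArg r m) +
      (Am (m.1 / r ^ 2) r)⁻¹ 1 1 • gradV ψ (psiArg r m))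

/-- Kinetic convolution operator for scalar kernels:
`[T_J f](z) = ∫ J(z⁻¹ ∘ m) f(m) dm`. -/
def Tsc {d : ℕ} (J : Pt d → ℝ) (f : Pt d → ℝ) (z : Pt d) : ℝ :=
  ∫ m, J (kmul (kinv z) m) * f m

/-- Kinetic convolution operator for `ℝ^d`-valued kernels:
`[T_J f](z) = ∫ J(z⁻¹ ∘ m) · f(m) dm`. -/
def Tvec {d : ℕ} (J : Pt d → V d) (f : Pt d → V d) (z : Pt d) : ℝ :=
  ∫ m, ⟪J (kmul (kinv z) m), f m⟫

/-- The support and nonnegativity conditions on the bump function `ψ`: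
smooth, nonnegative, unit mass, supported in `(−2,−1) × B₁(0) × B₁(0)`. -/
structure IsKineticBump {d : ℕ} (ψ : Pt d → ℝ) : Prop where
  smooth : ContDiff ℝ (⊤ : ℕ∞) ψ
  nonneg : ∀ m, 0 ≤ ψ m
  mass : ∫ m, ψ m = 1
  supp : ∀ m : Pt d, ψ m ≠ 0 →
    m.1 ∈ Set.Ioo (-2 : ℝ) (-1) ∧ ‖m.2.1‖ < 1 ∧ ‖m.2.2‖ < 1

/-- The kinetic box `B_r^kin = {(s,y,w) : |s| < r², |y| < r³, |w| < r}`. -/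
def kinBox (d : ℕ) (r : ℝ) : Set (Pt d) :=
  {m | |m.1| < r ^ 2 ∧ ‖m.2.1‖ < r ^ 3 ∧ ‖m.2.2‖ < r}

theorem hasDerivAt_g1 {r : ℝ} (hr : r ≠ 0) : HasDerivAt g1 (2 * r * h1 r) r := by
  refine ((hasDerivAt_pow 3 r).mul (Real.hasDerivAt_log hr).sin).congr_deriv ?_
  simp only [h1]
  field_simp
  push_cast
  ring

theorem hasDerivAt_g2 {r : ℝ} (hr : r ≠ 0) : HasDerivAt g2 (2 * r * h2 r) r := by
  refine ((hasDerivAt_pow 3 r).mul (Real.hasDerivAt_log hr).cos).congr_deriv ?_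
  simp only [h2]
  field_simp
  push_cast
  ring

theorem Dm_inv {δ : ℝ} (hδ : δ ≠ 0) : (Dm δ)⁻¹ = !![δ⁻¹, 0; 0, 1] := by
  refine Matrix.inv_eq_right_inv ?_
  simp [Dm, Matrix.one_fin_two, hδ]

theorem Am_eq {δ : ℝ} (hδ : δ ≠ 0) (r : ℝ) :
    Am δ r = !![g1 r, δ * g2 r; h1 r * δ⁻¹, h2 r] := by
  rw [Am, Dm_inv hδ]
  simp [Dm, Wm, mul_comm δ (g1 r), hδ]

/-- **(M1): kinetic trajectory identity.**
For every `m = (m₀,m₁,m₂)` with `m₀ ≠ 0`, every `(t,x,v)` and every `r > 0`,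
`(d/dr) γ^m_t = 2 m₀ r` and `(d/dr) γ^m_x(r) = (d/dr) γ^m_t(r) · γ^m_v(r) = 2 m₀ r · γ^m_v(r)`. -/
theorem statement0 (d : ℕ) (hd : 1 ≤ d) (m : Pt d) (hm0 : m.1 ≠ 0)
    (z : Pt d) (r : ℝ) (hr : 0 < r) :
    HasDerivAt (fun ρ => (gammaK m z ρ).1) (2 * m.1 * r) r ∧
    HasDerivAt (fun ρ => (gammaK m z ρ).2.1)
      ((2 * m.1 * r) • (gammaK m z r).2.2) r := by
  have hsq : HasDerivAt (fun ρ : ℝ => m.1 * ρ ^ 2) (2 * m.1 * r) r :=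
    ((hasDerivAt_pow 2 r).const_mul m.1).congr_deriv (by push_cast; ring)
  refine ⟨hsq.const_add z.1, ?_⟩
  simp only [gammaK, act, Am_eq hm0, Em, Prod.fst_add, Prod.snd_add, Matrix.of_apply,
    Matrix.cons_val', Matrix.cons_val_zero, Matrix.cons_val_one, Matrix.cons_val_fin_one]
  refine (((hsq.smul_const z.2.2).const_add ((1 : ℝ) • z.2.1)).add
    (((hasDerivAt_g1 hr.ne').smul_const m.2.1).add
      (((hasDerivAt_g2 hr.ne').const_mul m.1).smul_const m.2.2))).congr_deriv ?_
  match_scalars <;> field_simp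
  ring
end
end

section
/- (Lemma 2.2, size part.) There exists a constant C > 0 such that for every r > 0 and every (s,y,w) ∈ ℝ^{1+2d}: |K_r(s,y,w)| ≤ C r^{−Q}, |K⃗^π_r(s,y,w)| ≤ C r^{−Q}, |K⃗_r(s,y,w)| ≤ C r^{−Q}, and |K̃_r(s,y,w)| ≤ C r^{−Q+1}, where |·| denotes the absolute value, respectively the Euclidean norm on ℝ^d. -/
open MeasureTheory Real ENNReal
open scoped RealInnerProductSpace

noncomputable section

/-- The compact set `[−2,−1] × closedBall 0 1 × closedBall 0 1`. -/
def bumpBox (d : ℕ) : Set (Pt d) :=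
  Set.Icc (-2 : ℝ) (-1) ×ˢ Metric.closedBall (0 : V d) 1 ×ˢ Metric.closedBall (0 : V d) 1

lemma isCompact_bumpBox (d : ℕ) : IsCompact (bumpBox d) :=
  isCompact_Icc.prod ((isCompact_closedBall _ _).prod (isCompact_closedBall _ _))

lemma IsKineticBump.tsupport_subset {d : ℕ} {ψ : Pt d → ℝ} (hψ : IsKineticBump ψ) :
    tsupport ψ ⊆ bumpBox d := by
  refine closure_minimal (fun m hm => ?_) (isCompact_bumpBox d).isClosed
  obtain ⟨h, hx, hv⟩ := hψ.supp m hm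
  exact ⟨Set.Ioo_subset_Icc_self h, by simpa using hx.le, by simpa using hv.le⟩

lemma exists_norm_le_of_eq_zero_off {X E : Type*} [TopologicalSpace X] [NormedAddCommGroup E]
    {K : Set X} (hK : IsCompact K) {f : X → E} (hf : Continuous f)
    (h0 : ∀ x, x ∉ K → f x = 0) : ∃ C, 0 ≤ C ∧ ∀ x, ‖f x‖ ≤ C := by
  obtain ⟨C, hC⟩ := hK.exists_bound_of_continuousOn hf.continuousOn
  refine ⟨max C 0, le_max_right _ _, fun x => ?_⟩
  by_cases hx : x ∈ K
  · exact (hC x hx).trans (le_max_left _ _)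
  · simp [h0 x hx]

lemma IsKineticBump.fderiv_eq_zero {d : ℕ} {ψ : Pt d → ℝ} (hψ : IsKineticBump ψ) {z : Pt d}
    (hz : z ∉ bumpBox d) : fderiv ℝ ψ z = 0 :=
  Function.notMem_support.1 fun h =>
    hz (hψ.tsupport_subset (support_fderiv_subset ℝ h))

lemma IsKineticBump.gradX_eq_zero {d : ℕ} {ψ : Pt d → ℝ} (hψ : IsKineticBump ψ) {z : Pt d}
    (hz : z ∉ bumpBox d) : gradX ψ z = 0 := by
  ext i
  simp [gradX, mkV, hψ.fderiv_eq_zero hz]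

lemma IsKineticBump.gradV_eq_zero {d : ℕ} {ψ : Pt d → ℝ} (hψ : IsKineticBump ψ) {z : Pt d}
    (hz : z ∉ bumpBox d) : gradV ψ z = 0 := by
  ext i
  simp [gradV, mkV, hψ.fderiv_eq_zero hz]

lemma IsKineticBump.continuous_gradX {d : ℕ} {ψ : Pt d → ℝ} (hψ : IsKineticBump ψ) :
    Continuous (gradX ψ) :=
  (EuclideanSpace.equiv (Fin d) ℝ).symm.continuous.comp <| continuous_pi fun _ =>
    (hψ.smooth.continuous_fderiv (by simp)).clm_apply continuous_const

lemma IsKineticBump.continuous_gradV {d : ℕ} {ψ : Pt d → ℝ} (hψ : IsKineticBump ψ) :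
    Continuous (gradV ψ) :=
  (EuclideanSpace.equiv (Fin d) ℝ).symm.continuous.comp <| continuous_pi fun _ =>
    (hψ.smooth.continuous_fderiv (by simp)).clm_apply continuous_const

lemma hasDerivAt_h1 {r : ℝ} (hr : 0 < r) :
    HasDerivAt h1 (Real.sin (Real.log r) + 2 * Real.cos (Real.log r)) r := by
  have hl := Real.hasDerivAt_log hr.ne'
  refine (((hasDerivAt_id r).div_const 2).mul
    ((hl.sin.const_mul 3).add hl.cos)).congr_deriv ?_
  simp only [id, Pi.add_apply]
  field_simp
  ring

lemma hasDerivAt_h2 {r : ℝ} (hr : 0 < r) :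
    HasDerivAt h2 (Real.cos (Real.log r) - 2 * Real.sin (Real.log r)) r := by
  have hl := Real.hasDerivAt_log hr.ne'
  refine (((hasDerivAt_id r).div_const 2).mul
    ((hl.cos.const_mul 3).sub hl.sin)).congr_deriv ?_
  simp only [id, Pi.sub_apply]
  field_simp
  ring

lemma abs_F1_le {m0 r : ℝ} (hm : m0 ∈ Set.Icc (-2 : ℝ) (-1)) (hr : 0 < r) : |F1 m0 r| ≤ 3 := by
  have hm0 : |1 / m0| ≤ 1 := by
    rw [abs_div, abs_one, div_le_one (abs_pos.2 (by linarith [hm.2]))]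
    linarith [hm.2, neg_le_abs m0]
  have hd : |Real.sin (Real.log r) + 2 * Real.cos (Real.log r)| ≤ 3 := by
    have := Real.abs_sin_le_one (Real.log r)
    have := Real.abs_cos_le_one (Real.log r)
    rw [abs_le] at *
    constructor <;> linarith
  rw [F1, (hasDerivAt_h1 hr).deriv, abs_mul]
  simpa using mul_le_mul hm0 hd (abs_nonneg _) zero_le_one

lemma abs_F2_le {r : ℝ} (hr : 0 < r) : |F2 r| ≤ 3 := by
  have := Real.abs_sin_le_one (Real.log r)
  have := Real.abs_cos_le_one (Real.log r)
  rw [F2, (hasDerivAt_h2 hr).deriv]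
  rw [abs_le] at *
  constructor <;> linarith

lemma det_Wm (r : ℝ) : (Wm r).det = -(r ^ 4 / 2) := by
  rw [Wm, Matrix.det_fin_two_of, g1, g2, h1, h2]
  linear_combination (-(r ^ 4 / 2)) * Real.sin_sq_add_cos_sq (Real.log r)

lemma Am_inv {m0 r : ℝ} (hm : m0 ≠ 0) (hr : r ≠ 0) :
    (Am m0 r)⁻¹ =
      !![-2 * h2 r / r ^ 4, 2 * m0 * g2 r / r ^ 4;
        2 * h1 r / (m0 * r ^ 4), -2 * g1 r / r ^ 4] := by
  have hD : (Dm m0)⁻¹ = !![m0⁻¹, 0; 0, 1] := by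
    refine Matrix.inv_eq_right_inv ?_
    ext i j
    fin_cases i <;> fin_cases j <;> simp [Dm, Matrix.mul_apply, Fin.sum_univ_two, hm]
  have hdet : g1 r * h2 r - g2 r * h1 r = -(r ^ 4 / 2) := by
    simpa [Wm, Matrix.det_fin_two] using det_Wm r
  refine Matrix.inv_eq_right_inv ?_
  rw [Am, hD]
  ext i j
  fin_cases i <;> fin_cases j <;>
    simp [Dm, Wm, Matrix.mul_apply, Fin.sum_univ_two] <;> field_simp
  · linear_combination (-2) * hdet
  · ring
  · ring
  · linear_combination (-2) * hdet

lemma abs_Am_inv_zero_one_le {m0 r : ℝ} (hm : m0 ∈ Set.Icc (-2 : ℝ) (-1)) (hr : 0 < r) :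
    |(Am m0 r)⁻¹ 0 1| ≤ 4 / r := by
  have hm2 : |m0| ≤ 2 := abs_le.2 ⟨hm.1, by linarith [hm.2]⟩
  have h : (Am m0 r)⁻¹ 0 1 = 2 * (m0 * Real.cos (Real.log r)) / r := by
    rw [Am_inv (by linarith [hm.2]) hr.ne']
    simp only [Matrix.of_apply, Matrix.cons_val', Matrix.cons_val_zero, Matrix.cons_val_one,
      Matrix.cons_val_fin_one, g2]
    field_simp
  have hc := mul_le_mul hm2 (Real.abs_cos_le_one (Real.log r)) (abs_nonneg _) zero_le_two
  rw [h, abs_div, abs_mul, abs_mul, abs_of_pos hr, abs_of_pos (zero_lt_two' ℝ)]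
  gcongr
  linarith

lemma abs_Am_inv_one_one_le {m0 r : ℝ} (hm : m0 ≠ 0) (hr : 0 < r) :
    |(Am m0 r)⁻¹ 1 1| ≤ 2 / r := by
  have h : (Am m0 r)⁻¹ 1 1 = -2 * Real.sin (Real.log r) / r := by
    rw [Am_inv hm hr.ne']
    simp only [Matrix.of_apply, Matrix.cons_val', Matrix.cons_val_one,
      Matrix.cons_val_fin_one, g1]
    field_simp
  rw [h, abs_div, abs_mul, abs_of_pos hr]
  gcongr
  simpa using Real.abs_sin_le_one (Real.log r)

lemma abs_time_le {s r : ℝ} (hr : 0 < r) (hm : s / r ^ 2 ∈ Set.Icc (-2 : ℝ) (-1)) :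
    |s| ≤ 2 * r ^ 2 := by
  have hr2 : 0 < r ^ 2 := by positivity
  have h1 := (le_div_iff₀ hr2).1 hm.1
  have h2 := (div_le_iff₀ hr2).1 hm.2
  exact abs_le.2 ⟨by linarith, by linarith⟩

section KernelBounds

variable {d : ℕ} {ψ : Pt d → ℝ}

lemma abs_Kker_le {B : ℝ} (hB : ∀ z, |ψ z| ≤ B) {r : ℝ} (hr : 0 < r) (m : Pt d) :
    |Kker ψ r m| ≤ 2 ^ d * B * r ^ (-(4 * (d : ℤ) + 2)) := by
  have hp : 0 < r ^ (-(4 * (d : ℤ) + 2)) := zpow_pos hr _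
  rw [Kker, abs_mul, abs_of_pos (by positivity), mul_right_comm]
  gcongr
  exact hB _

lemma norm_Kvec_le (hψ : IsKineticBump ψ) {B : ℝ} (hB : ∀ z, |ψ z| ≤ B) {r : ℝ} (hr : 0 < r)
    (m : Pt d) : ‖Kvec ψ r m‖ ≤ 2 ^ d * B * 6 * r ^ (-(4 * (d : ℤ) + 2)) := by
  have hB0 : 0 ≤ B := (abs_nonneg _).trans (hB 0)
  have hp : 0 < r ^ (-(4 * (d : ℤ) + 2)) := zpow_pos hr _
  by_cases h0 : ψ (psiArg r m) = 0
  · rw [Kvec, h0, mul_zero, zero_smul, norm_zero]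
    positivity
  obtain ⟨ht, hx, hv⟩ := hψ.supp _ h0
  have hF : ‖F1 (m.1 / r ^ 2) r • (psiArg r m).2.1 + F2 r • (psiArg r m).2.2‖ ≤ 6 := by
    refine (norm_add_le _ _).trans ?_
    rw [norm_smul, norm_smul, Real.norm_eq_abs, Real.norm_eq_abs]
    have h1 := mul_le_mul (abs_F1_le (Set.Ioo_subset_Icc_self ht) hr) hx.le
      (norm_nonneg _) (by norm_num)
    have h2 := mul_le_mul (abs_F2_le hr) hv.le (norm_nonneg _) (by norm_num)
    simp only [psiArg] at h1 h2 ⊢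
    linarith
  have hc : ‖-(2 ^ d) * r ^ (-(4 * (d : ℤ) + 2)) * ψ (psiArg r m)‖ ≤
      2 ^ d * r ^ (-(4 * (d : ℤ) + 2)) * B := by
    rw [Real.norm_eq_abs, abs_mul, abs_mul, abs_neg, abs_of_pos hp, abs_of_pos (by positivity)]
    gcongr
    exact hB _
  rw [Kvec, norm_smul]
  calc _ ≤ 2 ^ d * r ^ (-(4 * (d : ℤ) + 2)) * B * 6 :=
        mul_le_mul hc hF (norm_nonneg _) (by positivity)
    _ = _ := by ring

lemma abs_Ktil_le (hψ : IsKineticBump ψ) {B : ℝ} (hB : ∀ z, |ψ z| ≤ B) {r : ℝ} (hr : 0 < r)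
    (m : Pt d) : |Ktil ψ r m| ≤ 2 ^ d * B * 4 * r ^ (-(4 * (d : ℤ) + 2) + 1) := by
  have hB0 : 0 ≤ B := (abs_nonneg _).trans (hB 0)
  by_cases h0 : ψ (psiArg r m) = 0
  · rw [Ktil, h0, mul_zero, abs_zero]
    positivity
  have hs := abs_time_le hr (Set.Ioo_subset_Icc_self (hψ.supp _ h0).1)
  have hp : 0 < r ^ (-(4 * (d : ℤ) + 2) - 1) := zpow_pos hr _
  rw [Ktil, abs_mul, abs_mul, abs_mul, abs_neg, abs_of_pos hp, abs_of_pos (by positivity)]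
  calc _ ≤ 2 ^ (d + 1) * (2 * r ^ 2) * r ^ (-(4 * (d : ℤ) + 2) - 1) * B := by
        gcongr
        exact hB _
    _ = _ := by
        rw [zpow_sub_one₀ hr.ne', zpow_add_one₀ hr.ne']
        field_simp
        ring

lemma norm_Kpi_le (hψ : IsKineticBump ψ) {G : ℝ} (hX : ∀ z, ‖gradX ψ z‖ ≤ G)
    (hV : ∀ z, ‖gradV ψ z‖ ≤ G) {r : ℝ} (hr : 0 < r) (m : Pt d) :
    ‖Kpi ψ r m‖ ≤ 2 ^ d * G * 24 * r ^ (-(4 * (d : ℤ) + 2)) := by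
  have hG0 : 0 ≤ G := (norm_nonneg _).trans (hX 0)
  by_cases hz : psiArg r m ∈ bumpBox d
  swap
  · rw [Kpi, hψ.gradX_eq_zero hz, hψ.gradV_eq_zero hz]
    simp only [smul_zero, add_zero, norm_zero]
    positivity
  have ht : m.1 / r ^ 2 ∈ Set.Icc (-2 : ℝ) (-1) := hz.1
  have hs := abs_time_le hr ht
  have hp : 0 < r ^ (-(4 * (d : ℤ) + 2) - 1) := zpow_pos hr _
  have hgrad : ‖(Am (m.1 / r ^ 2) r)⁻¹ 0 1 • gradX ψ (psiArg r m) +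
      (Am (m.1 / r ^ 2) r)⁻¹ 1 1 • gradV ψ (psiArg r m)‖ ≤ 4 / r * G + 2 / r * G := by
    refine (norm_add_le _ _).trans ?_
    rw [norm_smul, norm_smul, Real.norm_eq_abs, Real.norm_eq_abs]
    gcongr
    · exact abs_Am_inv_zero_one_le ht hr
    · exact hX _
    · exact abs_Am_inv_one_one_le (by linarith [ht.2]) hr
    · exact hV _
  rw [Kpi, norm_smul, Real.norm_eq_abs, abs_mul, abs_mul, abs_of_pos hp,
    abs_of_pos (by positivity)]
  calc _ ≤ 2 ^ (d + 1) * (2 * r ^ 2) * r ^ (-(4 * (d : ℤ) + 2) - 1) *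
        (4 / r * G + 2 / r * G) := by gcongr
    _ = _ := by
        rw [zpow_sub_one₀ hr.ne']
        field_simp
        ring

end KernelBounds

/-- **Lemma 2.2, size part.** There is `C > 0` such that for every `r > 0` and every
`(s,y,w)`: `|K_r| ≤ C r^{−Q}`, `|K⃗^π_r| ≤ C r^{−Q}`, `|K⃗_r| ≤ C r^{−Q}`, and
`|K̃_r| ≤ C r^{−Q+1}`, with `Q = 4d+2`. -/
theorem statement8 (d : ℕ) (hd : 1 ≤ d) (ψ : Pt d → ℝ) (hψ : IsKineticBump ψ) :
    ∃ C : ℝ, 0 < C ∧ ∀ r : ℝ, 0 < r → ∀ m : Pt d,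
      |Kker ψ r m| ≤ C * r ^ (-(4 * (d : ℤ) + 2)) ∧
      ‖Kpi ψ r m‖ ≤ C * r ^ (-(4 * (d : ℤ) + 2)) ∧
      ‖Kvec ψ r m‖ ≤ C * r ^ (-(4 * (d : ℤ) + 2)) ∧
      |Ktil ψ r m| ≤ C * r ^ (-(4 * (d : ℤ) + 2) + 1) := by
  obtain ⟨B, hB0, hB⟩ := exists_norm_le_of_eq_zero_off (isCompact_bumpBox d)
    hψ.smooth.continuous fun z hz => image_eq_zero_of_notMem_tsupport
      fun h => hz (hψ.tsupport_subset h)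
  obtain ⟨G₁, hG₁, hX⟩ := exists_norm_le_of_eq_zero_off (isCompact_bumpBox d)
    hψ.continuous_gradX fun _ => hψ.gradX_eq_zero
  obtain ⟨G₂, hG₂, hV⟩ := exists_norm_le_of_eq_zero_off (isCompact_bumpBox d)
    hψ.continuous_gradV fun _ => hψ.gradV_eq_zero
  set G := G₁ + G₂
  have hG0 : 0 ≤ G := add_nonneg hG₁ hG₂
  have hp : (0 : ℝ) < 2 ^ d := by positivity
  have hpB : 0 ≤ 2 ^ d * B := by positivity
  have hpG : 0 ≤ 2 ^ d * G := by positivity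
  refine ⟨2 ^ d * B * 6 + 2 ^ d * G * 24 + 1, by positivity, fun r hr m => ⟨?_, ?_, ?_, ?_⟩⟩
  · refine (abs_Kker_le hB hr m).trans ?_
    gcongr
    linarith
  · refine (norm_Kpi_le hψ (fun z => (hX z).trans (le_add_of_nonneg_right hG₂))
      (fun z => (hV z).trans (le_add_of_nonneg_left hG₁)) hr m).trans ?_
    gcongr
    linarith
  · refine (norm_Kvec_le hψ hB hr m).trans ?_
    gcongr
    linarith
  · refine (abs_Ktil_le hψ hB hr m).trans ?_
    gcongr
    linarith
end
end
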